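/- arXiv:physics/9908037 — 2 statements merged into one kernel-verified Lean document; each statement's English description precedes it below -/
import Mathlib

section
/- Let m be an integer and let Ψ : ℝ² → ℂ be equivariant of weight m and real-analytic at the origin. Then there exist a function g : ℝ → ℂ real-analytic at 0 and a neighborhood of the origin on which Ψ(x, y) = (x + i y)^{max(m,0)} (x − i y)^{max(−m,0)} · g(x² + y²). -/
open Filter Topology

/-- Counterclockwise rotation of the plane by angle `α`. -/
noncomputable def rot (α : ℝ) (x : ℝ × ℝ) : ℝ × ℝ :=
  (Real.cos α * x.1 - Real.sin α * x.2, Real.sin α * x.1 + Real.cos α * x.2)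

/-- A wave function `Ψ : ℝ² → ℂ` is equivariant of weight `m` if
`Ψ(R_α x) = e^{i m α} Ψ(x)` for all angles `α` and points `x`. -/
def Equivariant (m : ℤ) (Ψ : ℝ × ℝ → ℂ) : Prop :=
  ∀ (α : ℝ) (x : ℝ × ℝ), Ψ (rot α x) = Complex.exp ((m : ℂ) * α * Complex.I) * Ψ x

open Polynomial in
lemma aux_poly (n : ℕ) (p : ContinuousMultilinearMap ℝ (fun _ : Fin n => ℝ × ℝ) ℂ) :
    ∃ Q : ℂ[X], Q.natDegree ≤ 2 * n ∧ ∀ α : ℝ,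
      Complex.exp (α * Complex.I) ^ n * p (fun _ => (Real.cos α, Real.sin α)) =
        Q.eval (Complex.exp (α * Complex.I)) := by
  classical
  let A : ℂ[X] := C (1 / 2) * (X ^ 2 + 1)
  let B : ℂ[X] := C (-Complex.I / 2) * (X ^ 2 - 1)
  have hA : A.natDegree ≤ 2 := by
    simp only [A]; compute_degree
  have hB : B.natDegree ≤ 2 := by
    simp only [B]; compute_degree
  refine ⟨∑ S : Finset (Fin n), C (p (S.piecewise (fun _ => ((1 : ℝ), (0 : ℝ)))
    (fun _ => ((0 : ℝ), (1 : ℝ))))) * ∏ i, (if i ∈ S then A else B), ?_, ?_⟩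
  · apply natDegree_sum_le_of_forall_le
    intro S _
    refine (natDegree_C_mul_le _ _).trans ((natDegree_prod_le _ _).trans ?_)
    refine (Finset.sum_le_card_nsmul _ _ 2 ?_).trans ?_
    · intro i _
      split_ifs <;> assumption
    · simp [mul_comm]
  · intro α
    have hA' : A.eval (Complex.exp (α * Complex.I))
        = Complex.exp (α * Complex.I) * (Real.cos α : ℂ) := by
      simp only [A, eval_mul, eval_C, eval_add, eval_pow, eval_X, eval_one, Complex.exp_mul_I,
        Complex.ofReal_cos]
      have := Complex.sin_sq_add_cos_sq (α : ℂ)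
      have h2 := Complex.I_sq
      linear_combination (-1/2 : ℂ) * this + (1/2) * Complex.sin (α : ℂ) ^ 2 * h2
    have hB' : B.eval (Complex.exp (α * Complex.I))
        = Complex.exp (α * Complex.I) * (Real.sin α : ℂ) := by
      simp only [B, eval_mul, eval_C, eval_sub, eval_pow, eval_X, eval_one, Complex.exp_mul_I,
        Complex.ofReal_sin]
      have := Complex.sin_sq_add_cos_sq (α : ℂ)
      have h2 := Complex.I_sq
      linear_combination (-Complex.I/2 : ℂ) * this + (-Complex.I/2 * Complex.sin (α : ℂ) ^ 2 - Complex.sin (α : ℂ) * Complex.cos (α : ℂ)) * h2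
    have hv : (fun _ : Fin n => (Real.cos α, Real.sin α)) =
        (fun _ => Real.cos α • ((1 : ℝ), (0 : ℝ))) + (fun _ => Real.sin α • ((0 : ℝ), (1 : ℝ))) := by
      funext i; simp
    rw [hv, p.map_add_univ, eval_finsetSum, Finset.mul_sum]
    refine Finset.sum_congr rfl fun S _ => ?_
    have hS : S.piecewise (fun _ : Fin n => Real.cos α • ((1 : ℝ), (0 : ℝ)))
        (fun _ => Real.sin α • ((0 : ℝ), (1 : ℝ))) =
        fun i => (if i ∈ S then Real.cos α else Real.sin α) •
          (S.piecewise (fun _ => ((1 : ℝ), (0 : ℝ))) (fun _ => ((0 : ℝ), (1 : ℝ)))) i := by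
      funext i
      by_cases h : i ∈ S <;> simp [h]
    rw [hS, p.map_smul_univ, eval_mul, eval_C, eval_prod]
    have : ∀ i, (if i ∈ S then A else B).eval (Complex.exp (α * Complex.I)) =
        Complex.exp (α * Complex.I) * ((if i ∈ S then Real.cos α else Real.sin α : ℝ) : ℂ) := by
      intro i
      split_ifs
      · exact hA'
      · exact hB'
    simp only [this, Finset.prod_mul_distrib, Finset.prod_const, Finset.card_univ, Fintype.card_fin,
      Complex.real_smul, Complex.ofReal_prod]
    ring

lemma aux_infinite : (Set.range fun α : ℝ => Complex.exp (α * Complex.I)).Infinite := by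
  have : (Set.Ioc (-Real.pi) Real.pi).Infinite := Set.Ioc_infinite (by linarith [Real.pi_pos])
  refine (this.image (f := fun α : ℝ => Complex.exp (α * Complex.I)) ?_).mono
    (Set.image_subset_range _ _)
  intro a ha b hb hab
  have := congrArg Complex.arg hab
  simpa [Complex.arg_exp_mul_I, (toIocMod_eq_self _).2, show -Real.pi + 2 * Real.pi = Real.pi by ring,
    ha.1, ha.2, hb.1, hb.2, toIocMod_eq_self] using this

open Polynomial in
lemma aux_vanish (n : ℕ) (m : ℤ) (p : ContinuousMultilinearMap ℝ (fun _ : Fin n => ℝ × ℝ) ℂ)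
    (a : ℂ) (h : ∀ α : ℝ, p (fun _ => (Real.cos α, Real.sin α)) =
      Complex.exp ((m : ℂ) * α * Complex.I) * a) (hn : n < m.natAbs) : a = 0 := by
  obtain ⟨Q, hQ, hQe⟩ := aux_poly n p
  have key : ∀ α : ℝ, Complex.exp (α * Complex.I) ^ ((n : ℤ) + m) * a =
      Q.eval (Complex.exp (α * Complex.I)) := by
    intro α
    rw [← hQe, h, zpow_add₀ (Complex.exp_ne_zero _), zpow_natCast, ← Complex.exp_int_mul]
    ring_nf
  rcases le_or_gt 0 m with hm | hm
  · obtain ⟨k, rfl⟩ := Int.eq_ofNat_of_zero_le hm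
    have : C a * X ^ (n + k) = Q := by
      apply Polynomial.eq_of_infinite_eval_eq
      refine aux_infinite.mono ?_
      rintro _ ⟨α, rfl⟩
      have := key α
      rw [show ((n : ℤ) + (k : ℤ)) = ((n + k : ℕ) : ℤ) by push_cast; rfl, zpow_natCast] at this
      simp only [Set.mem_ofPred_eq, eval_C, eval_mul, eval_pow, eval_X, ← this]
      exact mul_comm _ _
    have h2 := congrArg (fun q => q.coeff (n + k)) this
    simp only [coeff_C_mul, coeff_X_pow_self, mul_one] at h2
    rw [h2]
    apply coeff_eq_zero_of_natDegree_lt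
    have : n < k := by simpa using hn
    omega
  · obtain ⟨k, hk⟩ := Int.eq_ofNat_of_zero_le (show 0 ≤ -((n : ℤ) + m) by omega)
    have hk0 : k ≠ 0 := by omega
    have : C a = X ^ k * Q := by
      apply Polynomial.eq_of_infinite_eval_eq
      refine aux_infinite.mono ?_
      rintro _ ⟨α, rfl⟩
      have := key α
      rw [show (n : ℤ) + m = -(k : ℤ) by omega, zpow_neg, zpow_natCast] at this
      simp only [Set.mem_ofPred_eq, eval_C, eval_mul, eval_pow, eval_X, ← this]
      rw [mul_inv_cancel_left₀ (pow_ne_zero _ (Complex.exp_ne_zero _))]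
    have h2 := congrArg (fun q => q.eval 0) this
    simpa [hk0] using h2

lemma aux_coeff (m : ℤ) (Ψ : ℝ × ℝ → ℂ) (hΨ : Equivariant m Ψ)
    (p : FormalMultilinearSeries ℝ (ℝ × ℝ) ℂ) (hp : HasFPowerSeriesAt Ψ p 0) (n : ℕ) (α : ℝ) :
    p n (fun _ => (Real.cos α, Real.sin α)) =
      Complex.exp ((m : ℂ) * α * Complex.I) * p n (fun _ => ((1 : ℝ), (0 : ℝ))) := by
  have hl : ∀ v : ℝ × ℝ, HasFPowerSeriesAt (fun r : ℝ => Ψ (r • v))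
      (p.compContinuousLinearMap (ContinuousLinearMap.toSpanSingleton ℝ v)) 0 := by
    intro v
    have := HasFPowerSeriesAt.compContinuousLinearMap (f := Ψ) (pf := p) (x := (0 : ℝ))
      (u := ContinuousLinearMap.toSpanSingleton ℝ v) (by simpa using hp)
    exact this
  have h1 := hl (Real.cos α, Real.sin α)
  have h2 := (hl (1, 0)).const_smul (c := Complex.exp ((m : ℂ) * α * Complex.I))
  have he : (fun r : ℝ => Ψ (r • (Real.cos α, Real.sin α))) =
      Complex.exp ((m : ℂ) * α * Complex.I) • (fun r : ℝ => Ψ (r • ((1 : ℝ), (0 : ℝ)))) := by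
    funext r
    have := hΨ α (r, 0)
    simp only [rot] at this
    simp only [Pi.smul_apply, smul_eq_mul, Prod.smul_mk, mul_one, mul_zero]
    rw [← this]
    congr 2 <;> ring
  rw [he] at h1
  have h3 := h1.eq_formalMultilinearSeries h2
  have h4 := congrArg (fun q : FormalMultilinearSeries ℝ ℝ ℂ => q n (fun _ => 1)) h3
  have hcomp : ∀ v : ℝ × ℝ,
      (p.compContinuousLinearMap (ContinuousLinearMap.toSpanSingleton ℝ v)) n (fun _ => (1 : ℝ)) =
        p n (fun _ => v) := by
    intro v
    rw [FormalMultilinearSeries.compContinuousLinearMap_apply]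
    congr 1
    funext i
    simp
  rw [← hcomp, ← hcomp]
  exact h4

lemma aux_radial (m : ℤ) (Ψ : ℝ × ℝ → ℂ) (hΨ : Equivariant m Ψ) (hA : AnalyticAt ℝ Ψ 0) :
    ∃ g : ℝ → ℂ, AnalyticAt ℝ g 0 ∧
      ∀ᶠ r in 𝓝 (0 : ℝ), Ψ (r, 0) = (r : ℂ) ^ m.natAbs * g (r ^ 2) := by
  obtain ⟨p, hp⟩ := hA
  have hc := aux_coeff m Ψ hΨ p hp
  set a : ℕ → ℂ := fun n => p n (fun _ => ((1 : ℝ), (0 : ℝ))) with ha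
  have hsmall : ∀ n, n < m.natAbs → a n = 0 := fun n hn =>
    aux_vanish n m (p n) (a n) (hc n) hn
  have hpar : ∀ n : ℕ, Odd ((n : ℤ) + m) → a n = 0 := by
    intro n hn
    have h1 := hc n Real.pi
    have h2 : (fun _ : Fin n => (Real.cos Real.pi, Real.sin Real.pi)) =
        fun _ => (-1 : ℝ) • ((1 : ℝ), (0 : ℝ)) := by
      funext i; simp
    rw [h2, (p n).map_smul_univ] at h1
    have h3 : Complex.exp ((m : ℂ) * (Real.pi : ℝ) * Complex.I) = (-1) ^ m := by
      rw [mul_assoc, Complex.exp_int_mul, Complex.exp_pi_mul_I]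
    rw [h3] at h1
    have h4 : ((-1 : ℂ)) ^ n * a n = (-1) ^ m * a n := by
      simpa using h1
    have h5 : ((-1 : ℂ)) ^ ((n : ℤ) + m) = -1 := hn.neg_one_zpow
    rw [zpow_add₀ (by norm_num), zpow_natCast] at h5
    have h6 : ((-1 : ℂ)) ^ n * (-1) ^ n = 1 := by
      rw [← mul_pow]; simp
    have : a n = - a n := by
      linear_combination ((-1 : ℂ)) ^ n * h4 - a n * h6 + a n * h5
    exact self_eq_neg.mp this
  set M := m.natAbs with hM
  set q : FormalMultilinearSeries ℝ ℝ ℂ := fun k =>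
    ContinuousMultilinearMap.mkPiRing ℝ (Fin k) (a (M + 2 * k)) with hq
  have hqpos : 0 < q.radius := by
    obtain ⟨ρ, hρ0, hρ⟩ := ENNReal.lt_iff_exists_nnreal_btwn.mp hp.radius_pos
    obtain ⟨C, hC0, hC⟩ := p.norm_mul_pow_le_of_lt_radius hρ
    have hρ0' : 0 < ρ := by exact_mod_cast hρ0
    have hρ1 : (0 : ℝ) < ρ := hρ0'
    have : ((ρ ^ 2 : NNReal) : ENNReal) ≤ q.radius := by
      apply q.le_radius_of_bound (C / ρ ^ M)
      intro k
      rw [le_div_iff₀ (by positivity)]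
      have h1 : ‖q k‖ = ‖a (M + 2 * k)‖ := by simp [hq]
      have h2 : ‖a (M + 2 * k)‖ ≤ ‖p (M + 2 * k)‖ := by
        have := (p (M + 2 * k)).le_opNorm (fun _ => ((1 : ℝ), (0 : ℝ)))
        simpa [Prod.norm_def] using this
      rw [h1]
      calc ‖a (M + 2 * k)‖ * ((ρ ^ 2 : NNReal) : ℝ) ^ k * (ρ : ℝ) ^ M
          = ‖a (M + 2 * k)‖ * (ρ : ℝ) ^ (M + 2 * k) := by push_cast; ring
        _ ≤ ‖p (M + 2 * k)‖ * (ρ : ℝ) ^ (M + 2 * k) := by gcongr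
        _ ≤ C := hC _
    refine lt_of_lt_of_le ?_ this
    exact_mod_cast pow_pos hρ0' 2
  refine ⟨q.sum, (q.hasFPowerSeriesOnBall hqpos).analyticAt, ?_⟩
  have ht : Tendsto (fun r : ℝ => (r, (0 : ℝ))) (𝓝 0) (𝓝 (0 : ℝ × ℝ)) := by
    have : Continuous (fun r : ℝ => (r, (0 : ℝ))) := by fun_prop
    exact this.tendsto 0
  filter_upwards [ht.eventually hp.eventually_hasSum] with r hr
  rw [zero_add] at hr
  have hterm : ∀ n, p n (fun _ => (r, (0 : ℝ))) = (r : ℂ) ^ n * a n := by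
    intro n
    have : (fun _ : Fin n => (r, (0 : ℝ))) = fun _ => r • ((1 : ℝ), (0 : ℝ)) := by
      funext i; simp
    rw [this, (p n).map_smul_univ]
    simp [ha]
  rw [← hr.tsum_eq]
  simp only [hterm]
  have hinj : Function.Injective (fun k : ℕ => M + 2 * k) := by
    intro i j hij
    simp only at hij
    omega
  rw [← hinj.tsum_eq]
  · rw [FormalMultilinearSeries.sum, ← tsum_mul_left]
    refine tsum_congr fun k => ?_
    simp [hq]
    ring
  · intro n hn
    have hn0 : a n ≠ 0 := right_ne_zero_of_mul hn
    have h1 : M ≤ n := by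
      by_contra h
      exact hn0 (hsmall n (by omega))
    have h2 : Even ((n : ℤ) + m) := by
      by_contra h
      exact hn0 (hpar n (Int.not_even_iff_odd.mp h))
    obtain ⟨t, ht⟩ := h2
    refine ⟨(n - M) / 2, ?_⟩
    simp only
    omega

theorem stmt4 (m : ℤ) (Ψ : ℝ × ℝ → ℂ) (hΨ : Equivariant m Ψ)
    (hA : AnalyticAt ℝ Ψ 0) :
    ∃ g : ℝ → ℂ, AnalyticAt ℝ g 0 ∧
      ∀ᶠ x in 𝓝 (0 : ℝ × ℝ),
        Ψ x = (Complex.ofReal x.1 + Complex.ofReal x.2 * Complex.I) ^ (max m 0).toNat *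
              (Complex.ofReal x.1 - Complex.ofReal x.2 * Complex.I) ^ (max (-m) 0).toNat *
              g (x.1 ^ 2 + x.2 ^ 2) := by
  obtain ⟨g, hg, h⟩ := aux_radial m Ψ hΨ hA
  refine ⟨g, hg, ?_⟩
  have ht : Tendsto (fun x : ℝ × ℝ => ‖(⟨x.1, x.2⟩ : ℂ)‖) (𝓝 0) (𝓝 0) := by
    have : Continuous (fun x : ℝ × ℝ => ‖(⟨x.1, x.2⟩ : ℂ)‖) :=
      (Complex.equivRealProdCLM.symm.continuous).norm
    have h2 := this.tendsto 0
    have h3 : ‖(⟨(0 : ℝ × ℝ).1, (0 : ℝ × ℝ).2⟩ : ℂ)‖ = 0 := by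
      rw [norm_eq_zero]; rfl
    rwa [h3] at h2
  filter_upwards [ht.eventually h] with x hx
  set z : ℂ := ⟨x.1, x.2⟩ with hz
  set θ := Complex.arg z with hθ
  have hr2 : ‖z‖ ^ 2 = x.1 ^ 2 + x.2 ^ 2 := by
    rw [← Complex.normSq_eq_norm_sq, Complex.normSq_apply]; simp only [hz]; ring
  have h1 : (Complex.ofReal x.1 + Complex.ofReal x.2 * Complex.I)
      = ‖z‖ * Complex.exp (θ * Complex.I) := by
    rw [Complex.norm_mul_exp_arg_mul_I]
    exact (Complex.mk_eq_add_mul_I _ _).symm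
  have h2 : (Complex.ofReal x.1 - Complex.ofReal x.2 * Complex.I)
      = ‖z‖ * Complex.exp (-(θ * Complex.I)) := by
    have := congrArg (starRingEnd ℂ) h1
    simp only [map_add, map_mul, Complex.conj_ofReal, Complex.conj_I, ← Complex.exp_conj] at this
    rw [show -(θ * Complex.I) = θ * -Complex.I by ring, ← this]
    ring
  have h3 : rot θ (‖z‖, 0) = x := by
    have e1 : ‖z‖ * Real.cos θ = x.1 := Complex.norm_mul_cos_arg z
    have e2 : ‖z‖ * Real.sin θ = x.2 := Complex.norm_mul_sin_arg z
    apply Prod.ext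
    · simp only [rot]; linarith
    · simp only [rot]; linarith
  have h4 := hΨ θ (‖z‖, 0)
  rw [h3, hx, hr2] at h4
  rw [h4, h1, h2, ← mul_assoc]
  congr 1
  rcases le_total 0 m with hm | hm
  · obtain ⟨k, rfl⟩ := Int.eq_ofNat_of_zero_le hm
    have a1 : (max (k : ℤ) 0).toNat = k := by omega
    have a2 : (max (-(k : ℤ)) 0).toNat = 0 := by omega
    have a3 : ((k : ℤ)).natAbs = k := by omega
    rw [a1, a2, a3, pow_zero, mul_one, mul_pow, ← Complex.exp_nat_mul, mul_comm]
    push_cast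
    ring_nf
  · obtain ⟨k, hk⟩ := Int.eq_ofNat_of_zero_le (show 0 ≤ -m by omega)
    obtain rfl : m = -(k : ℤ) := by omega
    have a1 : (max (-(k : ℤ)) 0).toNat = 0 := by omega
    have a2 : (max (-(-(k : ℤ))) 0).toNat = k := by omega
    have a3 : (-(k : ℤ)).natAbs = k := by omega
    rw [a1, a2, a3, pow_zero, one_mul, mul_pow, ← Complex.exp_nat_mul, mul_comm]
    push_cast
    ring_nf
end

section
/- Let q : ℝ → ℝ be real-analytic at 0, odd (q(−r) = −q(r)), with q′(0) ≠ 0, and let 𝐫 : ℝ → ℝ² be real-analytic at 0, odd (𝐫(−s) = −𝐫(s)), and satisfy ‖𝐫(q(r))‖ = r for all sufficiently small r ≥ 0. Then there exist open neighborhoods U and V of the origin in ℝ² and a map H : U → V such that: H is real-analytic on U with real-analytic inverse H^{-1} : V → U; H(R_α x) = R_α H(x) whenever x and R_α x lie in U, where R_α is the counterclockwise rotation of ℝ² by angle α; and H(𝐫(s)) = (s, 0) for all s in a neighborhood of 0. -/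
open Filter Topology

/-- Euclidean norm on the plane. -/
noncomputable def nrm (x : ℝ × ℝ) : ℝ := Real.sqrt (x.1 ^ 2 + x.2 ^ 2)

/-- An odd function analytic at `0` is `s * W (s ^ 2)` with `W` analytic at `0`. -/
theorem odd_factor (f : ℝ → ℝ) (hf : AnalyticAt ℝ f 0) (hodd : ∀ s, f (-s) = -f s) :
    ∃ W : ℝ → ℝ, AnalyticAt ℝ W 0 ∧ ∀ᶠ s in 𝓝 (0 : ℝ), f s = s * W (s ^ 2) := by
  obtain ⟨p, hp⟩ := hf
  rw [hasFPowerSeriesAt_iff] at hp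
  set c : ℕ → ℝ := fun n => p.coeff (2 * n + 1) with hc
  have hneg : Tendsto (fun s : ℝ => -s) (𝓝 0) (𝓝 0) := by
    simpa using (continuous_neg (G := ℝ)).tendsto 0
  have hodd' : ∀ᶠ s in 𝓝 (0 : ℝ), HasSum (fun n => s * ((s ^ 2) ^ n * c n)) (f s) := by
    filter_upwards [hp, hneg.eventually hp] with s h1 h2
    have h3 := (h1.sub h2).mul_left (1 / 2 : ℝ)
    have h4 : (1 / 2 : ℝ) * (f (0 + s) - f (0 + -s)) = f s := by
      rw [zero_add, zero_add, hodd]; ring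
    rw [h4] at h3
    have hinj : Function.Injective (fun n : ℕ => 2 * n + 1) := by
      intro a b h; simp only at h; omega
    rw [← hinj.hasSum_iff] at h3
    · refine (congrArg (fun g => HasSum g (f s)) (funext fun n => ?_)).mp h3
      have : Odd (2 * n + 1) := ⟨n, rfl⟩
      simp only [Function.comp, hc, smul_eq_mul, this.neg_pow]
      ring
    · intro n hn
      have : Even n := by
        rcases Nat.even_or_odd n with h | h
        · exact h
        · obtain ⟨k, hk⟩ := h
          exact absurd ⟨k, hk.symm⟩ hn
      simp [this.neg_pow]
  have hsum : ∀ᶠ t in 𝓝 (0 : ℝ), Summable (fun n => t ^ n * c n) := by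
    have ht : Tendsto (fun t : ℝ => √|t|) (𝓝 0) (𝓝 0) := by
      have : Continuous (fun t : ℝ => √|t|) := by fun_prop
      simpa using this.tendsto 0
    filter_upwards [ht.eventually hodd'] with t h
    by_cases h0 : t = 0
    · subst h0
      refine summable_of_ne_finset_zero (s := {0}) ?_
      intro n hn
      have : n ≠ 0 := by simpa using hn
      simp [this]
    · have hs : √|t| ≠ 0 := by
        rw [Real.sqrt_ne_zero']; positivity
      have h5 := (summable_mul_left_iff hs).1 h.summable
      rw [Real.sq_sqrt (abs_nonneg t)] at h5
      rw [← summable_abs_iff] at h5 ⊢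
      simpa [abs_mul, abs_pow] using h5
  refine ⟨fun t => ∑' n, t ^ n * c n, ⟨FormalMultilinearSeries.ofScalars ℝ c, ?_⟩, ?_⟩
  · rw [hasFPowerSeriesAt_iff]
    filter_upwards [hsum] with t h
    simpa [FormalMultilinearSeries.coeff_ofScalars] using h.hasSum
  · filter_upwards [hodd'] with s h
    rw [← h.tsum_eq, tsum_mul_left]

theorem rot_nrm (α : ℝ) (y : ℝ × ℝ) :
    (rot α y).1 ^ 2 + (rot α y).2 ^ 2 = y.1 ^ 2 + y.2 ^ 2 := by
  have := Real.sin_sq_add_cos_sq α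
  simp only [rot]
  linear_combination (y.1 ^ 2 + y.2 ^ 2) * this

theorem rot_neg_rot (α : ℝ) (y : ℝ × ℝ) : rot (-α) (rot α y) = y := by
  have := Real.sin_sq_add_cos_sq α
  simp only [rot, Real.cos_neg, Real.sin_neg]
  ext
  · simp only; linear_combination y.1 * this
  · simp only; linear_combination y.2 * this

/-- The linear map `x ↦ (a + i b) x`. -/
noncomputable def cmulCLM (a b : ℝ) : ℝ × ℝ →L[ℝ] ℝ × ℝ :=
  (a • ContinuousLinearMap.fst ℝ ℝ ℝ - b • ContinuousLinearMap.snd ℝ ℝ ℝ).prod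
    (b • ContinuousLinearMap.fst ℝ ℝ ℝ + a • ContinuousLinearMap.snd ℝ ℝ ℝ)

noncomputable def cmulEquiv (a b : ℝ) (h : a ^ 2 + b ^ 2 ≠ 0) : (ℝ × ℝ) ≃L[ℝ] ℝ × ℝ :=
  ContinuousLinearEquiv.equivOfInverse (cmulCLM a b)
    (cmulCLM (a / (a ^ 2 + b ^ 2)) (-b / (a ^ 2 + b ^ 2)))
    (by
      intro x
      ext <;> simp [cmulCLM] <;> field_simp <;> ring)
    (by
      intro x
      ext <;> simp [cmulCLM] <;> field_simp <;> ring)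

theorem cmulEquiv_coe (a b : ℝ) (h : a ^ 2 + b ^ 2 ≠ 0) :
    (cmulEquiv a b h : ℝ × ℝ →L[ℝ] ℝ × ℝ) = cmulCLM a b := rfl

/-- The equivariant map with multiplier `A + i B`. -/
noncomputable def eqK (A B : ℝ → ℝ) (y : ℝ × ℝ) : ℝ × ℝ :=
  (A (y.1 ^ 2 + y.2 ^ 2) * y.1 - B (y.1 ^ 2 + y.2 ^ 2) * y.2,
    B (y.1 ^ 2 + y.2 ^ 2) * y.1 + A (y.1 ^ 2 + y.2 ^ 2) * y.2)

theorem eqK_rot (A B : ℝ → ℝ) (α : ℝ) (y : ℝ × ℝ) :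
    eqK A B (rot α y) = rot α (eqK A B y) := by
  unfold eqK
  rw [rot_nrm]
  simp only [rot]
  ext
  · simp only; ring
  · simp only; ring

theorem eqK_analytic (A B : ℝ → ℝ) (hA : AnalyticAt ℝ A 0) (hB : AnalyticAt ℝ B 0) :
    AnalyticAt ℝ (eqK A B) 0 := by
  have h1 : AnalyticAt ℝ (fun y : ℝ × ℝ => y.1) 0 := analyticAt_fst
  have h2 : AnalyticAt ℝ (fun y : ℝ × ℝ => y.2) 0 := analyticAt_snd
  have hN : AnalyticAt ℝ (fun y : ℝ × ℝ => y.1 ^ 2 + y.2 ^ 2) 0 := (h1.pow 2).add (h2.pow 2)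
  have hA' : AnalyticAt ℝ (fun y : ℝ × ℝ => A (y.1 ^ 2 + y.2 ^ 2)) 0 :=
    AnalyticAt.fun_comp (g := A) (by simpa using hA) hN
  have hB' : AnalyticAt ℝ (fun y : ℝ × ℝ => B (y.1 ^ 2 + y.2 ^ 2)) 0 :=
    AnalyticAt.fun_comp (g := B) (by simpa using hB) hN
  exact ((hA'.mul h1).sub (hB'.mul h2)).prod ((hB'.mul h1).add (hA'.mul h2))

theorem eqK_fderiv (A B : ℝ → ℝ) (hA : AnalyticAt ℝ A 0) (hB : AnalyticAt ℝ B 0) :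
    HasFDerivAt (eqK A B) (cmulCLM (A 0) (B 0)) 0 := by
  have h1 : HasFDerivAt (fun y : ℝ × ℝ => y.1) (ContinuousLinearMap.fst ℝ ℝ ℝ) 0 := hasFDerivAt_fst
  have h2 : HasFDerivAt (fun y : ℝ × ℝ => y.2) (ContinuousLinearMap.snd ℝ ℝ ℝ) 0 := hasFDerivAt_snd
  have hN : DifferentiableAt ℝ (fun y : ℝ × ℝ => y.1 ^ 2 + y.2 ^ 2) 0 := by fun_prop
  have hA' : DifferentiableAt ℝ (fun y : ℝ × ℝ => A (y.1 ^ 2 + y.2 ^ 2)) 0 :=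
    DifferentiableAt.comp (g := A) (0 : ℝ × ℝ) (by simpa using hA.differentiableAt) hN
  have hB' : DifferentiableAt ℝ (fun y : ℝ × ℝ => B (y.1 ^ 2 + y.2 ^ 2)) 0 :=
    DifferentiableAt.comp (g := B) (0 : ℝ × ℝ) (by simpa using hB.differentiableAt) hN
  have := ((hA'.hasFDerivAt.mul h1).sub (hB'.hasFDerivAt.mul h2)).prodMk
    ((hB'.hasFDerivAt.mul h1).add (hA'.hasFDerivAt.mul h2))
  refine this.congr_fderiv ?_
  ext <;> simp [cmulCLM]

/-- The analytic, rotation-equivariant change of variables `H` of the proof of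
Theorem 2: given a valid two-body convention (odd analytic shape coordinate `q` with
`q′(0) ≠ 0`, odd analytic reference orientation `𝐫` with `‖𝐫(q(r))‖ = r`), there is a
local analytic diffeomorphism `H` between neighborhoods `U`, `V` of the origin of the
plane, commuting with rotations, which maps the reference curve to the positive
`x`-axis: `H(𝐫(s)) = (s, 0)`. -/
theorem stmt10 (q : ℝ → ℝ) (hq : AnalyticAt ℝ q 0) (hqodd : ∀ r : ℝ, q (-r) = -q r)
    (hq' : deriv q 0 ≠ 0)
    (rv : ℝ → ℝ × ℝ) (hrv : AnalyticAt ℝ rv 0) (hrvodd : ∀ s : ℝ, rv (-s) = -rv s)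
    (hnorm : ∀ᶠ r in 𝓝 (0 : ℝ), 0 ≤ r → nrm (rv (q r)) = r) :
    ∃ U V : Set (ℝ × ℝ), IsOpen U ∧ IsOpen V ∧ (0 : ℝ × ℝ) ∈ U ∧ (0 : ℝ × ℝ) ∈ V ∧
      ∃ H Hinv : ℝ × ℝ → ℝ × ℝ,
        Set.BijOn H U V ∧
        (∀ x ∈ U, AnalyticAt ℝ H x) ∧
        (∀ y ∈ V, AnalyticAt ℝ Hinv y) ∧
        (∀ x ∈ U, Hinv (H x) = x) ∧ (∀ y ∈ V, H (Hinv y) = y) ∧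
        (∀ (α : ℝ), ∀ x ∈ U, rot α x ∈ U → H (rot α x) = rot α (H x)) ∧
        ∀ᶠ s in 𝓝 (0 : ℝ), H (rv s) = (s, 0) := by
  obtain ⟨A, hA, hAeq⟩ := odd_factor (fun s => (rv s).1)
    (analyticAt_fst.comp hrv) (fun s => by simp [hrvodd])
  obtain ⟨B, hB, hBeq⟩ := odd_factor (fun s => (rv s).2)
    (analyticAt_snd.comp hrv) (fun s => by simp [hrvodd])
  have q0 : q 0 = 0 := by
    have := hqodd 0
    rw [neg_zero] at this
    linarith
  have hrvK : ∀ᶠ s in 𝓝 (0 : ℝ), rv s = eqK A B (s, 0) := by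
    filter_upwards [hAeq, hBeq] with s h1 h2
    ext
    · simpa [eqK, mul_comm] using h1
    · simpa [eqK, mul_comm] using h2
  -- non-degeneracy
  have hne : A 0 ^ 2 + B 0 ^ 2 ≠ 0 := by
    intro h0
    have hqc : Tendsto q (𝓝 0) (𝓝 0) := by
      simpa [q0] using hq.continuousAt.tendsto
    have hev : ∀ᶠ r in 𝓝[>] (0 : ℝ),
        (r⁻¹ * q r) ^ 2 * (A (q r ^ 2) ^ 2 + B (q r ^ 2) ^ 2) = 1 := by
      filter_upwards [(hnorm.filter_mono nhdsWithin_le_nhds),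
        (hqc.eventually hAeq).filter_mono nhdsWithin_le_nhds,
        (hqc.eventually hBeq).filter_mono nhdsWithin_le_nhds,
        self_mem_nhdsWithin] with r h1 h2 h3 hr
      have hr' : 0 < r := hr
      have h4 := h1 hr'.le
      have h5 : (rv (q r)).1 ^ 2 + (rv (q r)).2 ^ 2 = r ^ 2 := by
        have h6 : nrm (rv (q r)) ^ 2 = r ^ 2 := by rw [h4]
        rwa [nrm, Real.sq_sqrt (by positivity)] at h6
      rw [h2, h3] at h5
      field_simp
      linarith
    have hlim1 : Tendsto (fun r => r⁻¹ * q r) (𝓝[>] 0) (𝓝 (deriv q 0)) := by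
      have := hq.differentiableAt.hasDerivAt.tendsto_slope_zero_right
      simpa [q0] using this
    have hq2 : Tendsto (fun r => q r ^ 2) (𝓝[>] 0) (𝓝 0) := by
      simpa using (hqc.pow 2).mono_left nhdsWithin_le_nhds
    have hlim2 := (hlim1.pow 2).mul
      (((hA.continuousAt.tendsto.comp hq2).pow 2).add ((hB.continuousAt.tendsto.comp hq2).pow 2))
    rw [h0, mul_zero] at hlim2
    have hlim3 : Tendsto (fun _ : ℝ => (1 : ℝ)) (𝓝[>] 0) (𝓝 0) := by
      refine hlim2.congr' ?_
      filter_upwards [hev] with r h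
      exact h
    exact one_ne_zero (tendsto_nhds_unique tendsto_const_nhds hlim3)
  set K := eqK A B with hK
  have hKa : AnalyticAt ℝ K 0 := eqK_analytic A B hA hB
  have hKd : HasFDerivAt K (cmulEquiv (A 0) (B 0) hne : ℝ × ℝ →L[ℝ] ℝ × ℝ) 0 :=
    eqK_fderiv A B hA hB
  have hKs : HasStrictFDerivAt K (cmulEquiv (A 0) (B 0) hne : ℝ × ℝ →L[ℝ] ℝ × ℝ) 0 := by
    have := hKa.hasStrictFDerivAt
    rwa [hKd.fderiv] at this
  set e := hKs.toOpenPartialHomeomorph K with he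
  have heK : ∀ y, e y = K y := fun y => rfl
  have hsrc : (0 : ℝ × ℝ) ∈ e.source := hKs.mem_toOpenPartialHomeomorph_source
  have hKa' : AnalyticAt ℝ e.symm (K 0) :=
    e.analyticAt_symm' hsrc hKa hKd.fderiv
  have hgood : ∀ᶠ y in 𝓝 (0 : ℝ × ℝ), y ∈ e.source ∧ AnalyticAt ℝ K y ∧
      AnalyticAt ℝ e.symm (K y) :=
    (e.open_source.eventually_mem hsrc).and (hKa.eventually_analyticAt.and
      (hKa.continuousAt.eventually hKa'.eventually_analyticAt))
  obtain ⟨ε, hε, hball⟩ := Metric.eventually_nhds_iff.1 hgood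
  set V : Set (ℝ × ℝ) := {y | y.1 ^ 2 + y.2 ^ 2 < ε ^ 2} with hV
  have hVo : IsOpen V := isOpen_lt (by fun_prop) continuous_const
  have hV0 : (0 : ℝ × ℝ) ∈ V := by
    have : (0 : ℝ) ^ 2 + (0 : ℝ) ^ 2 < ε ^ 2 := by
      have : 0 < ε ^ 2 := by positivity
      simpa using this
    exact this
  have hVgood : ∀ y ∈ V, y ∈ e.source ∧ AnalyticAt ℝ K y ∧ AnalyticAt ℝ e.symm (K y) := by
    intro y hy
    apply hball
    have hy' : y.1 ^ 2 + y.2 ^ 2 < ε ^ 2 := hy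
    rw [dist_zero_right, Prod.norm_def, max_lt_iff]
    constructor
    · exact abs_lt_of_sq_lt_sq (by nlinarith [sq_nonneg y.2]) hε.le
    · exact abs_lt_of_sq_lt_sq (by nlinarith [sq_nonneg y.1]) hε.le
  have hleft : ∀ y ∈ V, e.symm (K y) = y := fun y hy => e.left_inv (hVgood y hy).1
  have hVrot : ∀ α, ∀ y ∈ V, rot α y ∈ V := by
    intro α y hy
    have : (rot α y).1 ^ 2 + (rot α y).2 ^ 2 < ε ^ 2 := by
      rw [rot_nrm]; exact hy
    exact this
  have hUo : IsOpen (K '' V) :=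
    e.isOpen_image_of_subset_source hVo (fun y hy => (hVgood y hy).1)
  have hK0 : K 0 = 0 := by simp [hK, eqK]
  refine ⟨K '' V, V, hUo, hVo, ⟨0, hV0, hK0⟩, hV0, e.symm, K, ⟨?_, ?_, ?_⟩, ?_, ?_, ?_, ?_, ?_, ?_⟩
  · rintro _ ⟨y, hy, rfl⟩
    rw [hleft y hy]; exact hy
  · rintro _ ⟨y, hy, rfl⟩ _ ⟨z, hz, rfl⟩ h
    rw [hleft y hy, hleft z hz] at h
    rw [h]
  · intro y hy
    exact ⟨K y, ⟨y, hy, rfl⟩, hleft y hy⟩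
  · rintro _ ⟨y, hy, rfl⟩
    exact (hVgood y hy).2.2
  · exact fun y hy => (hVgood y hy).2.1
  · rintro _ ⟨y, hy, rfl⟩
    rw [hleft y hy]
  · exact hleft
  · rintro α _ ⟨y, hy, rfl⟩ -
    rw [hleft y hy, hK, ← eqK_rot, ← hK, hleft _ (hVrot α y hy)]
  · have hc : Tendsto (fun s : ℝ => (s, (0 : ℝ))) (𝓝 0) (𝓝 (0 : ℝ × ℝ)) := by
      have : Continuous (fun s : ℝ => (s, (0 : ℝ))) := by fun_prop
      exact this.tendsto 0
    filter_upwards [hrvK, hc.eventually (hVo.mem_nhds hV0)] with s h1 h2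
    rw [h1, hleft _ h2]
end
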